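/- Let k ≥ 2 and for each n ∈ ℤ let (a_{n,1},…,a_{n,k}) be a k-tuple of positive integers with a_{n,1} ≥ a_{n,2} ≥ ⋯ ≥ a_{n,k} ≥ 1, and suppose (a_{n,1},…,a_{n,k}) = (1,…,1) for all n ≤ 0. Then there exists a Cantor real base B = (β_n)_{n∈ℤ} (in particular β_n > 1 for all n) such that for every n ∈ ℤ: (i) ∑_{j=1}^{k} a_{n−j+1,j}/(β_{n−1}β_{n−2}⋯β_{n−j}) = 1, and (ii) the sequence a_{n,1} a_{n−1,2} ⋯ a_{n−k+1,k} 0 0 0 ⋯ is the lexicographically greatest sequence 𝐛 = b_1b_2⋯ of nonnegative integers with ∑_{j=1}^{∞} b_j/(β_{n−1}β_{n−2}⋯β_{n−j}) = 1, i.e., it is the greedy S^n(B)-expansion of 1. -/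

import Mathlib

open Filter

/-- A Cantor real base: all entries `> 1`, with both one-sided partial products tending to `+∞`. -/
def IsCantorBase (B : ℤ → ℝ) : Prop :=
  (∀ n, 1 < B n) ∧
  Tendsto (fun N : ℕ => ∏ i ∈ Finset.range N, B (i + 1)) atTop atTop ∧
  Tendsto (fun N : ℕ => ∏ i ∈ Finset.range N, B (-(i + 1))) atTop atTop

/-- `valS B n a = val_{S^n(B)}(0 · a)`, where `a j` is the `(j+1)`-st digit. -/
noncomputable def valS (B : ℤ → ℝ) (n : ℤ) (a : ℕ → ℕ) : ℝ :=
  ∑' j : ℕ, (a j : ℝ) / ∏ i ∈ Finset.range (j + 1), B (n - 1 - i)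

/-- Strict lexicographic order on one-sided digit sequences. -/
def lexLt (x y : ℕ → ℕ) : Prop := ∃ j, (∀ i < j, x i = y i) ∧ x j < y j

def lexLe (x y : ℕ → ℕ) : Prop := x = y ∨ lexLt x y

/-- The sequence ends in a tail of zeros. -/
def EvZero (x : ℕ → ℕ) : Prop := ∃ N, ∀ j ≥ N, x j = 0

/-- `t` is the greedy `S^n(B)`-expansion of `1`: it is lexicographically greatest among
sequences of nonnegative integers with value `1`. -/
def IsGreedyOne (B : ℤ → ℝ) (n : ℤ) (t : ℕ → ℕ) : Prop :=
  valS B n t = 1 ∧ ∀ b : ℕ → ℕ, valS B n b = 1 → lexLe b t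

/-- `d` is the quasi-greedy `S^n(B)`-expansion of `1`: it is lexicographically greatest among
sequences of nonnegative integers not ending in a tail of zeros with value `1`. -/
def IsQuasiGreedyOne (B : ℤ → ℝ) (n : ℤ) (d : ℕ → ℕ) : Prop :=
  ¬ EvZero d ∧ valS B n d = 1 ∧
    ∀ b : ℕ → ℕ, ¬ EvZero b → valS B n b = 1 → lexLe b d

open Finset in
/-- A solution of the unit equation of the `k`-bonacci base, as an inverse base. -/
lemma exists_sum_pow_succ_eq_one {k : ℕ} (hk : 2 ≤ k) :
    ∃ x : ℝ, 0 < x ∧ x < 1 ∧ ∑ j ∈ range k, x ^ (j + 1) = 1 := by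
  have hc : ContinuousOn (fun x : ℝ => ∑ j ∈ range k, x ^ (j + 1)) (Set.Icc 0 1) := by
    fun_prop
  have hk' : (2 : ℝ) ≤ k := by exact_mod_cast hk
  obtain ⟨x, ⟨h0, h1⟩, hx⟩ := intermediate_value_Icc zero_le_one hc
    (show (1 : ℝ) ∈ Set.Icc _ _ by simp; linarith)
  dsimp only at hx
  refine ⟨x, h0.lt_of_ne ?_, h1.lt_of_ne ?_, hx⟩
  · rintro rfl
    simp at hx
  · rintro rfl
    simp at hx
    linarith

/-- The sequence equal to `x ^ (-n)` for `n ≤ 0` and continued to positive indices by the linear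
recurrence with coefficients `a (n - j) j`. -/
noncomputable def weight (k : ℕ) (a : ℤ → ℕ → ℕ) (x : ℝ) (n : ℤ) : ℝ :=
  if n ≤ 0 then x ^ (-n) else ∑ j ∈ Finset.range k, (a (n - j) j : ℝ) * weight k a x (n - 1 - j)
termination_by n.toNat
decreasing_by omega

lemma weight_of_nonpos (k : ℕ) (a : ℤ → ℕ → ℕ) (x : ℝ) {n : ℤ} (hn : n ≤ 0) :
    weight k a x n = x ^ (-n) := by
  rw [weight, if_pos hn]

lemma weight_rec {k : ℕ} {a : ℤ → ℕ → ℕ} {x : ℝ} (hx : 0 < x)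
    (hsum : ∑ j ∈ Finset.range k, x ^ (j + 1) = 1)
    (hone : ∀ n : ℤ, n ≤ 0 → ∀ j < k, a n j = 1) (n : ℤ) :
    weight k a x n = ∑ j ∈ Finset.range k, (a (n - j) j : ℝ) * weight k a x (n - 1 - j) := by
  rcases le_or_gt n 0 with hn | hn
  · calc weight k a x n = x ^ (-n) * ∑ j ∈ Finset.range k, x ^ (j + 1) := by
          rw [hsum, mul_one, weight_of_nonpos k a x hn]
      _ = _ := by
          rw [Finset.mul_sum]
          refine Finset.sum_congr rfl fun j hj => ?_
          rw [hone _ (by omega) j (Finset.mem_range.1 hj), weight_of_nonpos k a x (by omega),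
            Nat.cast_one, one_mul, ← zpow_natCast, ← zpow_add₀ hx.ne']
          congr 1
          push_cast
          ring
  · rw [weight, if_neg hn.not_ge]

lemma weight_pos {k : ℕ} (hk : 0 < k) {a : ℤ → ℕ → ℕ} {x : ℝ} (hx : 0 < x)
    (hpos : ∀ n : ℤ, ∀ j < k, 1 ≤ a n j) (n : ℤ) : 0 < weight k a x n := by
  fun_induction weight k a x n with
  | case1 n hn => exact zpow_pos hx _
  | case2 n hn ih =>
    refine Finset.sum_pos (fun j hj => mul_pos ?_ (ih j)) (by simpa using hk.ne')
    exact_mod_cast hpos _ j (Finset.mem_range.1 hj)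

section Recurrence

variable {k : ℕ} {a : ℤ → ℕ → ℕ} {P : ℤ → ℝ}

lemma add_le_of_rec (hk : 2 ≤ k) (hpos : ∀ n : ℤ, ∀ j < k, 1 ≤ a n j) (hP : ∀ n, 0 < P n)
    (hrec : ∀ n, P n = ∑ j ∈ Finset.range k, (a (n - j) j : ℝ) * P (n - 1 - j)) (n : ℤ) :
    P (n - 1) + P (n - 2) ≤ P n := by
  have h : ∑ j ∈ Finset.range 2, P (n - 1 - j) ≤ P n := by
    rw [hrec n]
    refine (Finset.sum_le_sum fun j hj => ?_).trans
      (Finset.sum_le_sum_of_subset_of_nonneg (Finset.range_mono hk) fun j _ _ =>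
        mul_nonneg (Nat.cast_nonneg _) (hP _).le)
    have h1 : (1 : ℝ) ≤ a (n - j) j := by
      exact_mod_cast hpos _ j ((Finset.mem_range.1 hj).trans_le hk)
    exact le_mul_of_one_le_left (hP _).le h1
  simpa [Finset.sum_range_succ, show n - 1 - 1 = n - 2 by ring] using h

lemma prod_div_eq (hP : ∀ n, 0 < P n) (n : ℤ) (m : ℕ) :
    ∏ i ∈ Finset.range m, P (n - 1 - i + 1) / P (n - 1 - i) = P n / P (n - m) := by
  induction m with
  | zero => simp [(hP n).ne']
  | succ m ih =>
    rw [Finset.prod_range_succ, ih, show n - 1 - (m : ℤ) + 1 = n - m by ring,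
      show n - ((m + 1 : ℕ) : ℤ) = n - 1 - m by push_cast; ring]
    have h1 := (hP (n - m)).ne'
    have h2 := (hP (n - 1 - m)).ne'
    field_simp

/-- Increasing any single digit of the expansion of `P n` by one and cutting behind it
overshoots `P n`. -/
lemma lt_sum_add_of_rec (hpos : ∀ n : ℤ, ∀ j < k, 1 ≤ a n j)
    (hmono : ∀ n : ℤ, ∀ j : ℕ, j + 1 < k → a n (j + 1) ≤ a n j) (hP : ∀ n, 0 < P n)
    (hrec : ∀ n, P n = ∑ j ∈ Finset.range k, (a (n - j) j : ℝ) * P (n - 1 - j))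
    (n : ℤ) (j : ℕ) :
    P n < ∑ i ∈ Finset.range (j + 1), ((if i < k then a (n - i) i else 0 : ℕ) : ℝ) * P (n - 1 - i)
      + P (n - 1 - j) := by
  have hn : P n = ∑ i ∈ Finset.range k,
      ((if i < k then a (n - i) i else 0 : ℕ) : ℝ) * P (n - 1 - i) := by
    rw [hrec n]
    exact Finset.sum_congr rfl fun i hi => by rw [if_pos (Finset.mem_range.1 hi)]
  rcases le_or_gt k (j + 1) with hj | hj
  · have := Finset.sum_le_sum_of_subset_of_nonneg (Finset.range_mono hj)
      (f := fun i : ℕ => ((if i < k then a (n - i) i else 0 : ℕ) : ℝ) * P (n - 1 - i))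
      fun i _ _ => mul_nonneg (Nat.cast_nonneg _) (hP _).le
    linarith [hP (n - 1 - j)]
  · obtain ⟨m, hm⟩ := Nat.exists_eq_add_of_lt hj
    have hanti : ∀ (q : ℤ) (l d : ℕ), d + l < k → a q (d + l) ≤ a q l := by
      intro q l d
      induction d with
      | zero => simp
      | succ d ih =>
        intro h
        rw [show d + 1 + l = d + l + 1 by ring] at h ⊢
        exact (hmono q _ h).trans (ih (by omega))
    have htail : ∑ i ∈ Finset.range (m + 1), ((if j + 1 + i < k then
        a (n - (j + 1 + i : ℕ)) (j + 1 + i) else 0 : ℕ) : ℝ) * P (n - 1 - (j + 1 + i : ℕ))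
        < P (n - 1 - j) := by
      rw [hrec (n - 1 - j)]
      refine (Finset.sum_le_sum fun i hi => ?_).trans_lt
        (Finset.sum_lt_sum_of_subset (Finset.range_mono (show m + 1 ≤ k by omega))
          (i := m + 1) (by simp; omega) (by simp) (mul_pos ?_ (hP _))
          fun i _ _ => mul_nonneg (Nat.cast_nonneg _) (hP _).le)
      · have hi' := Finset.mem_range.1 hi
        rw [if_pos (by omega), show n - 1 - ((j + 1 + i : ℕ) : ℤ) = n - 1 - j - 1 - i by
          push_cast; ring, show n - ((j + 1 + i : ℕ) : ℤ) = n - 1 - j - i by push_cast; ring]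
        refine mul_le_mul_of_nonneg_right ?_ (hP _).le
        exact_mod_cast hanti _ i (j + 1) (by omega)
      · exact_mod_cast hpos _ _ (by omega)
    rw [hn]
    conv_lhs => rw [show k = j + 1 + (m + 1) by omega]
    rw [Finset.sum_range_add, ← show k = j + 1 + (m + 1) by omega]
    linarith

lemma tendsto_atTop_of_rec (hk : 2 ≤ k) (hpos : ∀ n : ℤ, ∀ j < k, 1 ≤ a n j) (hP : ∀ n, 0 < P n)
    (hrec : ∀ n, P n = ∑ j ∈ Finset.range k, (a (n - j) j : ℝ) * P (n - 1 - j)) :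
    Tendsto (fun N : ℕ => P (N + 1)) atTop atTop := by
  have hlin : ∀ N : ℕ, P 0 * N ≤ P (N + 1) ∧ P 0 ≤ P N := by
    intro N
    induction N with
    | zero => simpa using (hP _).le
    | succ N ih =>
      have h := add_le_of_rec hk hpos hP hrec (N + 2)
      have h' := add_le_of_rec hk hpos hP hrec (N + 1)
      rw [show (N : ℤ) + 2 - 1 = N + 1 by ring, show (N : ℤ) + 2 - 2 = N by ring] at h
      rw [show (N : ℤ) + 1 - 1 = N by ring] at h'
      have hp := hP (N + 1 - 2)
      push_cast
      rw [show (N : ℤ) + 1 + 1 = N + 2 by ring]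
      constructor <;> linarith
  exact tendsto_atTop_mono (fun N => (hlin N).1)
    (tendsto_natCast_atTop_atTop.const_mul_atTop (hP 0))

end Recurrence

theorem stmt19 (k : ℕ) (hk : 2 ≤ k)
    (a : ℤ → ℕ → ℕ)  -- `a n j` is the digit `a_{n,j+1}` of the `k`-tuple attached to `n`
    (hpos : ∀ n : ℤ, ∀ j < k, 1 ≤ a n j)
    (hmono : ∀ n : ℤ, ∀ j : ℕ, j + 1 < k → a n (j + 1) ≤ a n j)
    (hone : ∀ n : ℤ, n ≤ 0 → ∀ j < k, a n j = 1) :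
    ∃ B : ℤ → ℝ, IsCantorBase B ∧
      ∀ n : ℤ,
        ((∑ j ∈ Finset.range k,
            (a (n - j) j : ℝ) / ∏ i ∈ Finset.range (j + 1), B (n - 1 - i)) = 1) ∧
        IsGreedyOne B n (fun j => if j < k then a (n - j) j else 0) := by
  obtain ⟨x, hx0, hx1, hsum⟩ := exists_sum_pow_succ_eq_one hk
  have hrec := weight_rec (a := a) hx0 hsum hone
  have hP := weight_pos (a := a) (by omega : 0 < k) hx0 hpos
  have hneg : ∀ N : ℕ, weight k a x (-N) = x ^ N := fun N => by
    rw [weight_of_nonpos k a x (by omega), neg_neg, zpow_natCast]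
  generalize weight k a x = P at hrec hP hneg
  have hterm : ∀ (n : ℤ) (c : ℝ) (j : ℕ), c / ∏ i ∈ Finset.range (j + 1),
      (fun m => P (m + 1) / P m) (n - 1 - i) = c * P (n - 1 - j) / P n := by
    intro n c j
    rw [prod_div_eq hP, show n - ((j + 1 : ℕ) : ℤ) = n - 1 - j by push_cast; ring, div_div_eq_mul_div]
  have hone_sum : ∀ n : ℤ, ∑ j ∈ Finset.range k, (a (n - j) j : ℝ) /
      ∏ i ∈ Finset.range (j + 1), (fun m => P (m + 1) / P m) (n - 1 - i) = 1 := by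
    intro n
    simp_rw [hterm]
    rw [← Finset.sum_div, ← hrec n, div_self (hP n).ne']
  refine ⟨fun m => P (m + 1) / P m, ⟨fun n => ?_, ?_, ?_⟩, fun n => ⟨hone_sum n, ?_, ?_⟩⟩
  · have h := add_le_of_rec hk hpos hP hrec (n + 1)
    rw [show n + 1 - 1 = n by ring] at h
    rw [one_lt_div (hP n)]
    linarith [hP (n + 1 - 2)]
  · have h : ∀ N : ℕ, ∏ i ∈ Finset.range N, P ((i : ℤ) + 1 + 1) / P (i + 1) = P (N + 1) / P 1 := by
      intro N
      induction N with
      | zero => simp [(hP 1).ne']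
      | succ N ih =>
        rw [Finset.prod_range_succ, ih]
        have h1 := (hP (N + 1)).ne'
        push_cast
        field_simp
    simp_rw [h]
    exact (tendsto_atTop_of_rec hk hpos hP hrec).atTop_div_const (hP 1)
  · have h : ∀ N : ℕ, ∏ i ∈ Finset.range N, P (-((i : ℤ) + 1) + 1) / P (-(i + 1)) = x⁻¹ ^ N := by
      intro N
      have h := prod_div_eq hP 0 N
      have h0 := hneg 0
      simp only [Nat.cast_zero, neg_zero, pow_zero] at h0
      rw [zero_sub (N : ℤ), hneg, h0, one_div, ← inv_pow] at h
      rw [← h]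
      exact Finset.prod_congr rfl fun i _ => by
        rw [show -((i : ℤ) + 1) = 0 - 1 - i by ring]
    simp_rw [h]
    exact tendsto_pow_atTop_atTop_of_one_lt ((one_lt_inv₀ hx0).2 hx1)
  · rw [valS, tsum_eq_sum (s := Finset.range k)]
    · rw [← hone_sum n]
      exact Finset.sum_congr rfl fun j hj => by rw [if_pos (Finset.mem_range.1 hj)]
    · intro j hj
      rw [if_neg (by simpa using hj), Nat.cast_zero, zero_div]
  · intro b hb
    rw [valS] at hb
    simp_rw [hterm] at hb
    have hs : HasSum (fun j => (b j : ℝ) * P (n - 1 - j) / P n) 1 := by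
      rw [← hb]
      refine Summable.hasSum (by_contra fun h => ?_)
      rw [tsum_eq_zero_of_not_summable h] at hb
      exact zero_ne_one hb
    by_contra hlex
    simp only [lexLe, not_or] at hlex
    obtain ⟨hne, hlt⟩ := hlex
    classical
    have hex := Function.ne_iff.1 hne
    obtain ⟨j, hj, hmin⟩ : ∃ j, b j ≠ (if j < k then a (n - j) j else 0) ∧
        ∀ i < j, b i = if i < k then a (n - i) i else 0 :=
      ⟨Nat.find hex, Nat.find_spec hex, fun i hi => not_not.1 (Nat.find_min hex hi)⟩
    have hgt : (if j < k then a (n - j) j else 0) + 1 ≤ b j := by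
      by_contra h
      exact hlt ⟨j, hmin, (Nat.lt_succ_iff.1 (not_le.1 h)).lt_of_ne hj⟩
    have hle := sum_le_hasSum (Finset.range (j + 1))
      (fun i _ => div_nonneg (mul_nonneg (Nat.cast_nonneg _) (hP _).le) (hP n).le) hs
    rw [← Finset.sum_div, div_le_one (hP n), Finset.sum_range_succ] at hle
    have hover := lt_sum_add_of_rec hpos hmono hP hrec n j
    rw [Finset.sum_range_succ, ← Finset.sum_congr rfl fun i hi => by
      rw [← hmin i (Finset.mem_range.1 hi)]] at hover
    have hgt' : (((if j < k then a (n - j) j else 0 : ℕ) : ℝ) + 1) * P (n - 1 - j)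
        ≤ b j * P (n - 1 - j) :=
      mul_le_mul_of_nonneg_right (by exact_mod_cast hgt) (hP _).le
    linarith
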